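/- Define the magnetic monopole 2-form ω on ℝ³∖{0} by ω(x)(u,v) = det(x, u, v)/‖x‖³, where det(x,u,v) is the determinant of the 3×3 matrix with columns x, u, v and ‖·‖ is the Euclidean norm. Then the singularity of ω at 0 is not removable: there exist no open neighborhood V of 0 in ℝ³ and no smooth maps s₁, s₂, s₃ : V → ℝ³ × (ℝ³)* that are linearly independent at every point of V and satisfy span{s₁(x), s₂(x), s₃(x)} = Graph(ω(x)) for all x ∈ V∖{0}. -/

import Mathlib

/-- The magnetic monopole 2-form on `ℝ³ ∖ {0}`:
`ω(x)(u,v) = det(x,u,v)/‖x‖³`, where `det(x,u,v)` is the determinant of the `3×3`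
matrix with columns `x, u, v` and `‖x‖` is the Euclidean norm. -/
noncomputable def monopole3dForm (x u v : Fin 3 → ℝ) : ℝ :=
  ((Matrix.of ![x, u, v]).transpose).det / Real.sqrt (x 0 ^ 2 + x 1 ^ 2 + x 2 ^ 2) ^ 3

open Filter Topology in
/-- Limits of points in the spans of a convergent finite family lie in the span of the limit
family, provided the latter is linearly independent. -/
theorem mem_span_range_of_tendsto {α E : Type*} [NormedAddCommGroup E] [NormedSpace ℝ E]
    {n : ℕ} {l : Filter α} [l.NeBot] {s : α → Fin n → E} {s₀ : Fin n → E} {p : α → E} {p₀ : E}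
    (hs₀ : LinearIndependent ℝ s₀) (hs : Tendsto s l (𝓝 s₀)) (hp : Tendsto p l (𝓝 p₀))
    (hmem : ∀ᶠ a in l, p a ∈ Submodule.span ℝ (Set.range (s a))) :
    p₀ ∈ Submodule.span ℝ (Set.range s₀) := by
  by_contra h
  have hli : LinearIndependent ℝ (Fin.cons p₀ s₀ : Fin (n + 1) → E) :=
    linearIndependent_finCons.2 ⟨hs₀, h⟩
  have hcons : Tendsto (fun a => (Fin.cons (p a) (s a) : Fin (n + 1) → E)) l
      (𝓝 (Fin.cons p₀ s₀)) := by
    refine tendsto_pi_nhds.2 fun i => ?_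
    refine Fin.cases ?_ (fun j => ?_) i
    · simpa using hp
    · simpa using (tendsto_pi_nhds.1 hs) j
  have hev := hcons.eventually (isOpen_setOfPred_linearIndependent.mem_nhds hli)
  obtain ⟨a, ha, ha'⟩ := (hev.and hmem).exists
  exact (linearIndependent_finCons.1 ha).2 ha'

theorem monopole3dForm_single (i : Fin 3) {t : ℝ} (ht : 0 < t) (u v : Fin 3 → ℝ) :
    monopole3dForm (Pi.single i t) u v =
      ((Matrix.of ![Pi.single i 1, u, v]).transpose).det / t ^ 2 := by
  have h : Real.sqrt (t ^ 2) = t := Real.sqrt_sq ht.le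
  fin_cases i <;> simp [monopole3dForm, Matrix.det_fin_three, h] <;> field_simp

/-- The singularity of the magnetic monopole 2-form on `ℝ³` at
the origin is not removable: there is no open neighborhood `V` of `0` with smooth,
everywhere linearly independent sections `s₁, s₂, s₃ : V → ℝ³ × (ℝ³)*` whose span
at every `x ∈ V ∖ {0}` is the graph `{(X, ω(x)(X,·))}`.  Here `(ℝ³)*` is identified
with `ℝ³` via the dual standard basis, so `ω(x)(X,·)` has coordinates
`j ↦ ω(x)(X, e_j)`. -/
theorem stmt_17 :
    ¬ ∃ (V : Set (Fin 3 → ℝ)) (s : Fin 3 → (Fin 3 → ℝ) → (Fin 3 → ℝ) × (Fin 3 → ℝ)),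
      IsOpen V ∧ (0 : Fin 3 → ℝ) ∈ V ∧
      (∀ i, ContDiffOn ℝ (⊤ : ℕ∞) (s i) V) ∧
      (∀ x ∈ V, LinearIndependent ℝ (fun i => s i x)) ∧
      ∀ x ∈ V, x ≠ 0 →
        (Submodule.span ℝ (Set.range fun i => s i x) : Set ((Fin 3 → ℝ) × (Fin 3 → ℝ))) =
          {p | ∃ X : Fin 3 → ℝ, p = (X, fun j => monopole3dForm x X (Pi.single j 1))} := by
  rintro ⟨V, s, hV, h0, hs, hli, hgraph⟩
  have hcont (i : Fin 3) : Filter.Tendsto (fun t : ℝ => (Pi.single i t : Fin 3 → ℝ))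
      (nhdsWithin 0 (Set.Ioi 0)) (nhds 0) := by
    have h := (continuous_single (A := fun _ : Fin 3 => ℝ) i).tendsto (0 : ℝ)
    rw [Pi.single_zero] at h
    exact h.mono_left nhdsWithin_le_nhds
  have key (i : Fin 3) (p : ℝ → (Fin 3 → ℝ) × (Fin 3 → ℝ)) (hp : Continuous p)
      (hmem : ∀ t > 0, ∃ X : Fin 3 → ℝ,
        p t = (X, fun j => monopole3dForm (Pi.single i t) X (Pi.single j 1))) :
      p 0 ∈ Submodule.span ℝ (Set.range fun i => s i 0) := by
    refine mem_span_range_of_tendsto (l := nhdsWithin (0 : ℝ) (Set.Ioi 0))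
      (s := fun t j => s j (Pi.single i t)) (hli 0 h0) (tendsto_pi_nhds.2 fun j => ?_)
      ((hp.tendsto 0).mono_left nhdsWithin_le_nhds) ?_
    · exact (((hs j).continuousOn.continuousAt (hV.mem_nhds h0)).tendsto).comp (hcont i)
    · filter_upwards [(hcont i).eventually (hV.mem_nhds h0), self_mem_nhdsWithin] with t htV ht
      rw [← SetLike.mem_coe, hgraph _ htV (by simpa using ne_of_gt ht)]
      exact hmem t ht
  have hfst (i : Fin 3) :
      ((Pi.single i 1, 0) : (Fin 3 → ℝ) × (Fin 3 → ℝ)) ∈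
        Submodule.span ℝ (Set.range fun i => s i 0) := by
    refine key i (fun _ => (Pi.single i 1, 0)) continuous_const fun t ht => ⟨Pi.single i 1, ?_⟩
    refine Prod.ext rfl (funext fun j => ?_)
    dsimp only
    rw [monopole3dForm_single i ht, Matrix.det_transpose,
      Matrix.det_zero_of_row_eq (i := 0) (j := 1) (by decide) rfl]
    simp
  have hsnd : ((0, Pi.single 2 1) : (Fin 3 → ℝ) × (Fin 3 → ℝ)) ∈
      Submodule.span ℝ (Set.range fun i => s i 0) := by
    have h := key 0 (fun t => (Pi.single 1 (t ^ 2), Pi.single 2 1))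
      (((continuous_single (A := fun _ : Fin 3 => ℝ) 1).comp (continuous_pow 2)).prodMk
        continuous_const) fun t ht => ⟨Pi.single 1 (t ^ 2), ?_⟩
    · simpa using h
    · refine Prod.ext rfl (funext fun j => ?_)
      dsimp only
      rw [monopole3dForm_single 0 ht]
      fin_cases j <;> simp [Matrix.det_fin_three, ht.ne']
  let b : Fin 4 → (Fin 3 → ℝ) × (Fin 3 → ℝ) :=
    ![(Pi.single 0 1, 0), (Pi.single 1 1, 0), (Pi.single 2 1, 0), (0, Pi.single 2 1)]
  have hb : LinearIndependent ℝ b := by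
    rw [Fintype.linearIndependent_iff]
    intro g hg
    have h1 := congrArg Prod.fst hg
    have h2 := congrFun (congrArg Prod.snd hg) 2
    have h10 := congrFun h1 0
    have h11 := congrFun h1 1
    have h12 := congrFun h1 2
    simp [b, Fin.sum_univ_four] at h2 h10 h11 h12
    intro i
    fin_cases i <;> assumption
  have hle : Submodule.span ℝ (Set.range b) ≤ Submodule.span ℝ (Set.range fun i => s i 0) := by
    rw [Submodule.span_le]
    rintro _ ⟨i, rfl⟩
    fin_cases i
    exacts [hfst 0, hfst 1, hfst 2, hsnd]
  have hrank := Submodule.finrank_mono hle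
  rw [finrank_span_eq_card hb, finrank_span_eq_card (hli 0 h0)] at hrank
  simp at hrank
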